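/- Let (Γ; ≤₁, …, ≤ₙ) be a homogeneous n-dimensional permutation structure. Let E < G be ∅-definable equivalence relations on Γ with E meet-reducible (there exist ∅-definable equivalence relations G₁ ≠ E and G₂ ≠ E with E = G₁ ⊓ G₂), and let < be a ∅-definable subquotient order from E to G such that for every ∅-definable equivalence relation H with E < H < G, < is not H-convex. Then there exist a ∅-definable equivalence relation F with E < F and a ∅-definable subquotient order <' from F to the join F ⊔ G such that: (i) for all x, y ∈ Γ, x < y iff (x G y and x <' y), i.e., < is the restriction of <' to G; and (ii) for all x, y ∈ Γ, x <' y iff there exists z with x F z and z < y (so < and <' are interdefinable). -/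

import Mathlib

/-- An `n`-dimensional permutation structure: a set `Γ` equipped with `n` linear orders. -/
structure PermStruct (n : ℕ) (Γ : Type*) where
  le : Fin n → Γ → Γ → Prop
  total : ∀ i x y, le i x y ∨ le i y x
  antisymm : ∀ i x y, le i x y → le i y x → x = y
  trans : ∀ i x y z, le i x y → le i y z → le i x z

namespace PermStruct

variable {n : ℕ} {Γ : Type*} (S : PermStruct n Γ)

/-- An automorphism of the permutation structure: a bijection of `Γ` preserving each order. -/
def IsAuto (σ : Γ ≃ Γ) : Prop :=
  ∀ i x y, S.le i x y ↔ S.le i (σ x) (σ y)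

/-- Homogeneity: every isomorphism between finite substructures (i.e. every bijection between
finite subsets preserving each order) extends to an automorphism. -/
def Homogeneous : Prop :=
  ∀ (A : Finset Γ) (f : Γ → Γ), Set.InjOn f A →
    (∀ i, ∀ x ∈ A, ∀ y ∈ A, (S.le i x y ↔ S.le i (f x) (f y))) →
    ∃ σ : Γ ≃ Γ, S.IsAuto σ ∧ ∀ a ∈ A, σ a = f a

/-- A binary relation is ∅-definable iff it is invariant under all automorphisms. -/
def Definable (R : Γ → Γ → Prop) : Prop :=
  ∀ σ : Γ ≃ Γ, S.IsAuto σ → ∀ x y, R x y ↔ R (σ x) (σ y)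

/-- `E` is `≤ᵢ`-convex: every `E`-class is an interval with respect to `≤ᵢ`. -/
def Convex (i : Fin n) (E : Γ → Γ → Prop) : Prop :=
  ∀ x y z, S.le i x y → S.le i y z → E x z → E x y

end PermStruct

/-- Given equivalence relations `E ≤ F` on `X`, a subquotient order from `E` to `F` is a binary
relation `lt` such that: `lt x y` implies `F x y` and not `E x y`; `lt` is `E`-invariant on both
sides; `lt` is transitive; and whenever `F x y` and not `E x y`, exactly one of `lt x y`,
`lt y x` holds. -/
def IsSubquotientOrder {X : Type*} (E F lt : X → X → Prop) : Prop :=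
  (∀ x y, lt x y → F x y ∧ ¬ E x y) ∧
  (∀ x y x' y', lt x y → E x x' → E y y' → lt x' y') ∧
  (∀ x y z, lt x y → lt y z → lt x z) ∧
  (∀ x y, F x y → ¬ E x y → ((lt x y ∨ lt y x) ∧ ¬ (lt x y ∧ lt y x)))

/-- Shift lemma for pairs: every finite colouring of pairs of naturals gives the same colour to
`(a, b)` and `(b, c)` for some `a < b < c`. -/
theorem exists_shift_pair {K : Type*} [Finite K] (f : ℕ → ℕ → K) :
    ∃ a b c, a < b ∧ b < c ∧ f a b = f b c := by
  obtain ⟨a, b, hab, h⟩ := Finite.exists_ne_map_eq_of_infinite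
    (fun a => {k : K | ∃ b, a < b ∧ f a b = k})
  wlog hlt : a < b generalizing a b
  · exact this b a hab.symm h.symm (lt_of_le_of_ne (not_lt.mp hlt) hab.symm)
  have hmem : f a b ∈ {k : K | ∃ c, b < c ∧ f b c = k} := by
    rw [← show _ = {k : K | ∃ c, b < c ∧ f b c = k} from h]
    exact ⟨b, hlt, rfl⟩
  obtain ⟨c, hbc, hc⟩ := hmem
  exact ⟨a, b, c, hlt, hbc, hc.symm⟩

/-- Shift lemma for triples. -/
theorem exists_shift_triple {K : Type*} [Finite K] (f : ℕ → ℕ → ℕ → K) :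
    ∃ a b c d, a < b ∧ b < c ∧ c < d ∧ f a b c = f b c d := by
  obtain ⟨a, b, c, hab, hbc, h⟩ := exists_shift_pair
    (fun a b => {k : K | ∃ c, b < c ∧ f a b c = k})
  have hmem : f a b c ∈ {k : K | ∃ d, c < d ∧ f b c d = k} := by
    rw [← show _ = {k : K | ∃ d, c < d ∧ f b c d = k} from h]
    exact ⟨c, hbc, rfl⟩
  obtain ⟨d, hcd, hd⟩ := hmem
  exact ⟨a, b, c, d, hab, hbc, hcd, hd.symm⟩

namespace PermStruct

/-- The quantifier-free type of a pair. -/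
def pairType {n : ℕ} {Γ : Type*} (S : PermStruct n Γ) (x y : Γ) : Fin n → Prop × Prop :=
  fun i => (S.le i x y, S.le i y x)

section PairTypes

variable {n : ℕ} {Γ : Type*} {S : PermStruct n Γ}

theorem pairType_eq_iff {x y x' y' : Γ} : S.pairType x y = S.pairType x' y' ↔
    ∀ i, (S.le i x y ↔ S.le i x' y') ∧ (S.le i y x ↔ S.le i y' x') := by
  simp [pairType, funext_iff]

theorem pairType_swap {x y x' y' : Γ} (h : S.pairType x y = S.pairType x' y') :
    S.pairType y x = S.pairType y' x' := by
  rw [pairType_eq_iff] at *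
  exact fun i => (h i).symm

theorem pairType_self (x y : Γ) : S.pairType x x = S.pairType y y := by
  rw [pairType_eq_iff]
  intro i
  have h1 := S.total i x x
  have h2 := S.total i y y
  tauto

theorem pairType_trans {x y z : Γ} (h : S.pairType x y = S.pairType y z) :
    S.pairType x z = S.pairType x y := by
  rw [pairType_eq_iff] at *
  intro i
  obtain ⟨h1, h2⟩ := h i
  refine ⟨⟨fun h => ?_, fun h => S.trans i x y z h (h1.mp h)⟩,
    ⟨fun h => ?_, fun h => S.trans i z y x (h2.mp h) h⟩⟩
  · rcases S.total i x y with hxy | hyx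
    · exact hxy
    · exact S.trans i x z y h (h2.mp hyx)
  · rcases S.total i x y with hxy | hyx
    · exact S.trans i y z x (h1.mp hxy) h
    · exact hyx

theorem pairType_eq_pairType_left {x y z : Γ} (h : S.pairType x y = S.pairType y z) :
    S.pairType z x = S.pairType z y :=
  pairType_swap ((pairType_trans h).trans h)

theorem IsAuto.pairType {σ : Γ ≃ Γ} (hσ : S.IsAuto σ) (x y : Γ) :
    S.pairType (σ x) (σ y) = S.pairType x y := by
  rw [pairType_eq_iff]
  exact fun i => ⟨(hσ i x y).symm, (hσ i y x).symm⟩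

theorem IsAuto.symm {σ : Γ ≃ Γ} (hσ : S.IsAuto σ) : S.IsAuto σ.symm := by
  intro i x y
  rw [hσ i (σ.symm x) (σ.symm y)]
  simp

theorem definable_of_imp {R : Γ → Γ → Prop}
    (h : ∀ σ : Γ ≃ Γ, S.IsAuto σ → ∀ x y, R x y → R (σ x) (σ y)) : S.Definable R := by
  intro σ hσ x y
  refine ⟨h σ hσ x y, fun hR => ?_⟩
  simpa using h σ.symm hσ.symm _ _ hR

theorem Definable.and {R R' : Γ → Γ → Prop} (h : S.Definable R) (h' : S.Definable R') :
    S.Definable (fun x y => R x y ∧ R' x y) :=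
  fun σ hσ x y => and_congr (h σ hσ x y) (h' σ hσ x y)

/-- Homogeneity, in terms of finite tuples with equal quantifier-free pair types. -/
def PairHomogeneous {n : ℕ} {Γ : Type*} (S : PermStruct n Γ) : Prop :=
  ∀ (k : ℕ) (u v : Fin k → Γ), (∀ a b, S.pairType (u a) (u b) = S.pairType (v a) (v b)) →
    ∃ σ : Γ ≃ Γ, S.IsAuto σ ∧ ∀ a, σ (u a) = v a

theorem eq_of_pairType_eq_self (hn : 0 < n) {x y z : Γ} (h : S.pairType x y = S.pairType z z) :
    x = y := by
  rw [pairType_eq_iff] at h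
  have hz := S.total ⟨0, hn⟩ z z
  exact S.antisymm ⟨0, hn⟩ x y ((h _).1.mpr (by tauto)) ((h _).2.mpr (by tauto))

theorem Homogeneous.pairHomogeneous (hn : 0 < n) (hhom : S.Homogeneous) :
    S.PairHomogeneous := by
  classical
  intro k u v h
  have huv : ∀ a b, u a = u b → v a = v b := fun a b hab =>
    eq_of_pairType_eq_self hn (z := u b) (by rw [← h, hab])
  have hvu : ∀ a b, v a = v b → u a = u b := fun a b hab =>
    eq_of_pairType_eq_self hn (z := v b) (by rw [h, hab])
  let f : Γ → Γ := fun x => if hx : ∃ a, u a = x then v hx.choose else x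
  have hf : ∀ a, f (u a) = v a := by
    intro a
    have hx : ∃ b, u b = u a := ⟨a, rfl⟩
    have : f (u a) = v hx.choose := dif_pos hx
    rw [this]
    exact huv _ _ hx.choose_spec
  obtain ⟨σ, hσ, hσf⟩ := hhom (Finset.univ.image u) f (by
      intro x hx y hy hxy
      simp only [Finset.coe_image, Finset.coe_univ, Set.image_univ, Set.mem_range] at hx hy
      obtain ⟨a, rfl⟩ := hx
      obtain ⟨b, rfl⟩ := hy
      rw [hf, hf] at hxy
      exact hvu _ _ hxy) (by
      intro i x hx y hy
      simp only [Finset.mem_image, Finset.mem_univ, true_and] at hx hy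
      obtain ⟨a, rfl⟩ := hx
      obtain ⟨b, rfl⟩ := hy
      rw [hf, hf]
      exact (pairType_eq_iff.mp (h a b) i).1)
  exact ⟨σ, hσ, fun a => (hσf _ (Finset.mem_image_of_mem u (Finset.mem_univ a))).trans (hf a)⟩

theorem PairHomogeneous.exists_auto (hS : S.PairHomogeneous) (x y : Γ) :
    ∃ σ : Γ ≃ Γ, S.IsAuto σ ∧ σ x = y := by
  obtain ⟨σ, hσ, h⟩ := hS 1 ![x] ![y] (by simp [pairType_self x y])
  exact ⟨σ, hσ, h 0⟩

theorem PairHomogeneous.exists_auto_pair (hS : S.PairHomogeneous) {x y x' y' : Γ}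
    (h : S.pairType x y = S.pairType x' y') :
    ∃ σ : Γ ≃ Γ, S.IsAuto σ ∧ σ x = x' ∧ σ y = y' := by
  obtain ⟨σ, hσ, hσ'⟩ := hS 2 ![x, y] ![x', y'] (by
    simp [Fin.forall_fin_two, pairType_self x x', pairType_self y y', h, pairType_swap h])
  exact ⟨σ, hσ, hσ' 0, hσ' 1⟩

theorem PairHomogeneous.exists_auto_triple (hS : S.PairHomogeneous) {x y z x' y' z' : Γ}
    (hxy : S.pairType x y = S.pairType x' y') (hxz : S.pairType x z = S.pairType x' z')
    (hyz : S.pairType y z = S.pairType y' z') :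
    ∃ σ : Γ ≃ Γ, S.IsAuto σ ∧ σ x = x' ∧ σ y = y' ∧ σ z = z' := by
  obtain ⟨σ, hσ, hσ'⟩ := hS 3 ![x, y, z] ![x', y', z'] (by
    simp [Fin.forall_fin_succ, pairType_self x x', pairType_self y y', pairType_self z z', hxy,
      pairType_swap hxy, hxz, pairType_swap hxz, hyz, pairType_swap hyz])
  exact ⟨σ, hσ, hσ' 0, hσ' 1, hσ' 2⟩

theorem Definable.congr_pairType (hS : S.PairHomogeneous) {R : Γ → Γ → Prop}
    (hR : S.Definable R) {x y x' y' : Γ} (h : S.pairType x y = S.pairType x' y') :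
    R x y ↔ R x' y' := by
  obtain ⟨σ, hσ, rfl, rfl⟩ := hS.exists_auto_pair h
  exact hR σ hσ x y

/-- Every pair type is realised by all increasing pairs of some infinite sequence. -/
theorem PairHomogeneous.exists_chain (hS : S.PairHomogeneous) (x y : Γ) :
    ∃ c : ℕ → Γ, ∀ j k, j < k → S.pairType (c j) (c k) = S.pairType x y := by
  obtain ⟨σ, hσ, hxy⟩ := hS.exists_auto x y
  let c : ℕ → Γ := fun k => σ^[k] x
  have hsucc : ∀ k, S.pairType (c k) (c (k + 1)) = S.pairType x y := by
    intro k
    induction k with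
    | zero => simp [c, hxy]
    | succ k ih =>
      rw [← ih, ← hσ.pairType (c k)]
      simp only [c, Function.iterate_succ_apply']
  refine ⟨c, fun j k hjk => ?_⟩
  induction k, hjk using Nat.le_induction with
  | base => exact hsucc j
  | succ m hm ih => exact (pairType_trans (ih.trans (hsucc m).symm)).trans ih

theorem PairHomogeneous.exists_between (hS : S.PairHomogeneous) (x y : Γ) :
    ∃ z, S.pairType x z = S.pairType x y ∧ S.pairType z y = S.pairType x y := by
  obtain ⟨c, hc⟩ := hS.exists_chain x y
  obtain ⟨σ, hσ, h0, h2⟩ := hS.exists_auto_pair (hc 0 2 (by norm_num))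
  refine ⟨σ (c 1), ?_, ?_⟩
  · rw [← hc 0 1 (by norm_num), ← hσ.pairType (c 0), h0]
  · rw [← hc 1 2 (by norm_num), ← hσ.pairType (c 1), h2]

/-- Definable equivalence relations commute under relational composition. -/
theorem PairHomogeneous.comm (hS : S.PairHomogeneous) {F G : Γ → Γ → Prop}
    (hF : S.Definable F) (hFe : Equivalence F) (hG : S.Definable G) (hGe : Equivalence G)
    {x y : Γ} (h : ∃ z, F x z ∧ G z y) : ∃ z, G x z ∧ F z y := by
  by_contra hcon
  obtain ⟨c, hc⟩ := hS.exists_chain x y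
  have hex : ∀ j k, ∃ z, j < k → F (c j) z ∧ G z (c k) := by
    intro j k
    by_cases hjk : j < k
    · obtain ⟨z, hz⟩ := h
      obtain ⟨σ, hσ, h1, h2⟩ := hS.exists_auto_pair (hc j k hjk).symm
      refine ⟨σ z, fun _ => ?_⟩
      rw [← h1, ← h2, ← hF σ hσ, ← hG σ hσ]
      exact hz
    · exact ⟨x, fun h => absurd h hjk⟩
  have hno : ∀ j k, j < k → ∀ z, ¬ (G (c j) z ∧ F z (c k)) := by
    intro j k hjk z hz
    obtain ⟨σ, hσ, h1, h2⟩ := hS.exists_auto_pair (hc j k hjk)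
    refine hcon ⟨σ z, ?_⟩
    rw [← h1, ← h2, ← hF σ hσ, ← hG σ hσ]
    exact hz
  choose X hX using hex
  obtain ⟨a, b, d, e, hab, hbd, hde, h⟩ :=
    exists_shift_triple (fun a b d => S.pairType (X a b) (X b d))
  obtain ⟨σ, hσ, h1, h2⟩ := hS.exists_auto_pair (pairType_eq_pairType_left h).symm
  refine hno b d hbd (σ (c d)) ⟨?_, ?_⟩
  · have h3 : G (X b d) (c d) := (hX b d hbd).2
    rw [hG σ hσ, h2] at h3
    exact hGe.trans (hGe.symm (hX a b hab).2) h3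
  · have h3 : F (c d) (X d e) := (hX d e hde).1
    have h4 := h3
    rw [hF σ hσ, h1] at h4
    exact hFe.trans h4 (hFe.symm h3)

/-- Lifting lemma: if `F ⊓ G = E`, a definable subquotient order from `E` to `G` does not change
when both arguments are moved within their `F`-classes. -/
theorem PairHomogeneous.lt_of_lt_of_rel (hS : S.PairHomogeneous) {E F G lt : Γ → Γ → Prop}
    (hEe : Equivalence E)
    (hF : S.Definable F) (hFe : Equivalence F) (hG : S.Definable G) (hGe : Equivalence G)
    (hEF : ∀ x y, E x y → F x y) (hFG : ∀ x y, F x y → G x y → E x y)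
    (hlt : IsSubquotientOrder E G lt) (hltd : S.Definable lt)
    {x y x' y' : Γ} (hxx : F x x') (hyy : F y y') (hGxy' : G x' y') (hxy : lt x y) :
    lt x' y' := by
  obtain ⟨hl1, hl2, hl3, hl4⟩ := hlt
  have hirr : ∀ {u v}, lt u v → ¬ lt v u := fun {u v} h1 h2 =>
    (hl4 u v (hl1 _ _ h1).1 (hl1 _ _ h1).2).2 ⟨h1, h2⟩
  by_contra hcon
  have hyx : lt y' x' := by
    have hE : ¬ E x' y' := fun h => (hl1 _ _ hxy).2
      (hFG _ _ (hFe.trans hxx (hFe.trans (hEF _ _ h) (hFe.symm hyy))) (hl1 _ _ hxy).1)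
    exact ((hl4 _ _ hGxy' hE).1).resolve_left hcon
  obtain ⟨z, hz⟩ := hS.exists_chain x' y
  have hex : ∀ j k, ∃ q, F q (z j) ∧ G q (z k) ∧ (j ≠ k → lt q (z k)) := by
    intro j k
    rcases lt_trichotomy j k with hjk | rfl | hjk
    · obtain ⟨σ, hσ, h1, h2⟩ := hS.exists_auto_pair (hz j k hjk).symm
      refine ⟨σ x, ?_, ?_, fun _ => ?_⟩
      · rw [← h1, ← hF σ hσ]; exact hxx
      · rw [← h2, ← hG σ hσ]; exact (hl1 _ _ hxy).1
      · rw [← h2, ← hltd σ hσ]; exact hxy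
    · exact ⟨z j, hFe.refl _, hGe.refl _, fun h => absurd rfl h⟩
    · obtain ⟨σ, hσ, h1, h2⟩ := hS.exists_auto_pair (hz k j hjk).symm
      refine ⟨σ y', ?_, ?_, fun _ => ?_⟩
      · rw [← h2, ← hF σ hσ]; exact hFe.symm hyy
      · rw [← h1, ← hG σ hσ]; exact hGe.symm hGxy'
      · rw [← h1, ← hltd σ hσ]; exact hyx
  choose Q hQF hQG hQlt using hex
  have hsep : ∀ a b b' j k, j ≠ k → lt (Q a k) (Q j k) →
      S.pairType (Q j k) (Q a b) ≠ S.pairType (Q j k) (Q k b') := by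
    intro a b b' j k hjk h heq
    obtain ⟨σ, hσ, h1, h2⟩ := hS.exists_auto_pair heq
    have hFs : F (σ (Q a k)) (z k) := by
      have h3 : F (Q a k) (Q a b) := hFe.trans (hQF a k) (hFe.symm (hQF a b))
      rw [hF σ hσ, h2] at h3
      exact hFe.trans h3 (hQF k b')
    have h4 : lt (σ (Q a k)) (Q j k) := by rwa [hltd σ hσ, h1] at h
    have hGs : G (σ (Q a k)) (z k) := hGe.trans (hl1 _ _ h4).1 (hQG j k)
    exact hirr (hl2 _ _ _ _ h4 (hFG _ _ hFs hGs) (hEe.refl _)) (hQlt j k hjk)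
  have hne : ∀ j k, j ≠ k → ¬ F (z j) (z k) := fun j k hjk h =>
    (hl1 _ _ (hQlt j k hjk)).2 (hFG _ _ (hFe.trans (hQF j k) h) (hQG j k))
  obtain ⟨a, b, c, d, hab, hbc, hcd, h⟩ := exists_shift_triple (fun a b c =>
    (S.pairType (Q b a) (Q c b), S.pairType (Q a b) (Q b c), lt (Q a b) (Q c b)))
  simp only [Prod.mk.injEq] at h
  obtain ⟨h1, h2, h3⟩ := h
  by_cases hlast : lt (Q b c) (Q d c)
  · exact hsep b a b d c hcd.ne' hlast (pairType_eq_pairType_left h1)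
  · rw [← h3] at hlast
    have hE : ¬ E (Q a b) (Q c b) := fun hE => hne a c (hab.trans hbc).ne
      (hFe.trans (hFe.symm (hQF a b)) (hFe.trans (hEF _ _ hE) (hQF c b)))
    have h5 := (hl4 _ _ (hGe.trans (hQG a b) (hGe.symm (hQG c b))) hE).1.resolve_left hlast
    exact hsep c d c a b hab.ne h5 (pairType_trans h2)

/-- A definable subquotient order between definable equivalence relations in a homogeneous
permutation structure. -/
structure IsDefinableSubquotientOrder {n : ℕ} {Γ : Type*} (S : PermStruct n Γ)
    (E G lt : Γ → Γ → Prop) : Prop where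
  hom : S.PairHomogeneous
  bot_def : S.Definable E
  bot_equiv : Equivalence E
  top_def : S.Definable G
  top_equiv : Equivalence G
  bot_le_top : ∀ x y, E x y → G x y
  order : IsSubquotientOrder E G lt
  lt_def : S.Definable lt

/-- `lt` is convex for no definable equivalence relation strictly between `E` and `G`. -/
def NoConvex {n : ℕ} {Γ : Type*} (S : PermStruct n Γ) (E G lt : Γ → Γ → Prop) : Prop :=
  ∀ H : Γ → Γ → Prop, S.Definable H → Equivalence H →
    (∀ x y, E x y → H x y) → (¬ ∀ x y, H x y → E x y) →
    (∀ x y, H x y → G x y) → (¬ ∀ x y, G x y → H x y) →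
    ¬ (∀ x y z, lt x y → lt y z → H x z → H x y)

namespace IsDefinableSubquotientOrder

variable {E G lt : Γ → Γ → Prop}

theorem top_of_lt (h : S.IsDefinableSubquotientOrder E G lt) {x y : Γ} (hxy : lt x y) : G x y :=
  (h.order.1 x y hxy).1

theorem not_bot_of_lt (h : S.IsDefinableSubquotientOrder E G lt) {x y : Γ} (hxy : lt x y) :
    ¬ E x y :=
  (h.order.1 x y hxy).2

theorem lt_trans (h : S.IsDefinableSubquotientOrder E G lt) {x y z : Γ} (hxy : lt x y)
    (hyz : lt y z) : lt x z :=
  h.order.2.2.1 x y z hxy hyz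

theorem lt_congr_left (h : S.IsDefinableSubquotientOrder E G lt) {x x' y : Γ} (hxy : lt x y)
    (hx : E x x') : lt x' y :=
  h.order.2.1 _ _ _ _ hxy hx (h.bot_equiv.refl y)

theorem lt_congr_right (h : S.IsDefinableSubquotientOrder E G lt) {x y y' : Γ} (hxy : lt x y)
    (hy : E y y') : lt x y' :=
  h.order.2.1 _ _ _ _ hxy (h.bot_equiv.refl x) hy

theorem lt_asymm (h : S.IsDefinableSubquotientOrder E G lt) {x y : Γ} (hxy : lt x y) : ¬ lt y x :=
  fun hyx => (h.order.2.2.2 x y (h.top_of_lt hxy) (h.not_bot_of_lt hxy)).2 ⟨hxy, hyx⟩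

theorem lt_or_lt (h : S.IsDefinableSubquotientOrder E G lt) {x y : Γ} (hG : G x y)
    (hE : ¬ E x y) : lt x y ∨ lt y x :=
  (h.order.2.2.2 x y hG hE).1

theorem lt_trans_le (h : S.IsDefinableSubquotientOrder E G lt) {x y z : Γ} (hxy : lt x y)
    (hyz : lt y z ∨ E y z) : lt x z :=
  hyz.elim (h.lt_trans hxy) (h.lt_congr_right hxy)

theorem le_trans_lt (h : S.IsDefinableSubquotientOrder E G lt) {x y z : Γ}
    (hxy : lt x y ∨ E x y) (hyz : lt y z) : lt x z :=
  hxy.elim (fun hxy => h.lt_trans hxy hyz)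
    (fun hxy => h.lt_congr_left hyz (h.bot_equiv.symm hxy))

theorem le_trans (h : S.IsDefinableSubquotientOrder E G lt) {x y z : Γ}
    (hxy : lt x y ∨ E x y) (hyz : lt y z ∨ E y z) : lt x z ∨ E x z := by
  rcases hyz with hyz | hyz
  · exact Or.inl (h.le_trans_lt hxy hyz)
  · exact hxy.imp (fun hxy => h.lt_congr_right hxy hyz) (fun hxy => h.bot_equiv.trans hxy hyz)

theorem top_of_le (h : S.IsDefinableSubquotientOrder E G lt) {x y : Γ}
    (hxy : lt x y ∨ E x y) : G x y :=
  hxy.elim h.top_of_lt (h.bot_le_top x y)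

theorem le_or_lt (h : S.IsDefinableSubquotientOrder E G lt) {x y : Γ} (hG : G x y) :
    (lt x y ∨ E x y) ∨ lt y x := by
  by_cases hE : E x y
  · exact Or.inl (Or.inr hE)
  · exact (h.lt_or_lt hG hE).imp Or.inl id

theorem le_def (h : S.IsDefinableSubquotientOrder E G lt) :
    S.Definable (fun x y => lt x y ∨ E x y) :=
  fun σ hσ x y => or_congr (h.lt_def σ hσ x y) (h.bot_def σ hσ x y)

theorem exists_upper_bound (h : S.IsDefinableSubquotientOrder E G lt) {K : Type*} [Finite K]
    (x : Γ) (f : K → Γ) (hf : ∀ k, G x (f k)) :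
    ∃ m, (lt x m ∨ E x m) ∧ ∀ k, lt (f k) m ∨ E (f k) m := by
  classical
  have key : ∀ s : Finset K, ∃ m, (lt x m ∨ E x m) ∧ ∀ k ∈ s, lt (f k) m ∨ E (f k) m := by
    intro s
    induction s using Finset.induction_on with
    | empty => exact ⟨x, Or.inr (h.bot_equiv.refl x), by simp⟩
    | insert a s ha ih =>
      obtain ⟨m, hxm, hm⟩ := ih
      rcases h.le_or_lt (h.top_equiv.trans (h.top_equiv.symm (hf a)) (h.top_of_le hxm)) with h1 | h1
      · exact ⟨m, hxm, by simpa using ⟨h1, hm⟩⟩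
      · refine ⟨f a, Or.inl (h.le_trans_lt hxm h1), fun k hk => ?_⟩
        rcases Finset.mem_insert.mp hk with rfl | hk
        · exact Or.inr (h.bot_equiv.refl _)
        · exact Or.inl (h.le_trans_lt (hm k hk) h1)
  have := Fintype.ofFinite K
  obtain ⟨m, h1, h2⟩ := key Finset.univ
  exact ⟨m, h1, fun k => h2 k (Finset.mem_univ k)⟩

theorem flip (h : S.IsDefinableSubquotientOrder E G lt) :
    S.IsDefinableSubquotientOrder E G (fun x y => lt y x) where
  hom := h.hom
  bot_def := h.bot_def
  bot_equiv := h.bot_equiv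
  top_def := h.top_def
  top_equiv := h.top_equiv
  bot_le_top := h.bot_le_top
  order := ⟨fun _ _ hxy => ⟨h.top_equiv.symm (h.top_of_lt hxy),
      fun hE => h.not_bot_of_lt hxy (h.bot_equiv.symm hE)⟩,
    fun _ _ _ _ hxy hx hy => h.order.2.1 _ _ _ _ hxy hy hx,
    fun _ _ _ hxy hyz => h.lt_trans hyz hxy,
    fun _ _ hG hE => ⟨(h.lt_or_lt hG hE).symm, fun hh => h.lt_asymm hh.1 hh.2⟩⟩
  lt_def := fun σ hσ x y => h.lt_def σ hσ y x

/-- The pair type `t` is realised cofinally, for `lt`, over every point. -/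
def Cofinal {n : ℕ} {Γ : Type*} (S : PermStruct n Γ) (G lt : Γ → Γ → Prop)
    (t : Fin n → Prop × Prop) : Prop :=
  ∀ x y, G x y → ∃ z, S.pairType x z = t ∧ lt y z

theorem exists_cofinal_bound (h : S.IsDefinableSubquotientOrder E G lt) (x : Γ) :
    ∃ m, (lt x m ∨ E x m) ∧ ∀ z, lt m z → Cofinal S G lt (S.pairType x z) := by
  have hex : ∀ t : Fin n → Prop × Prop, ∃ y, G x y ∧
      (¬ Cofinal S G lt t → ∀ z, S.pairType x z = t → ¬ lt y z) := by
    intro t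
    by_cases ht : Cofinal S G lt t
    · exact ⟨x, h.top_equiv.refl x, fun hn => absurd ht hn⟩
    · have ht' := ht
      unfold Cofinal at ht'
      push Not at ht'
      obtain ⟨u, v, huv, hv⟩ := ht'
      obtain ⟨σ, hσ, rfl⟩ := h.hom.exists_auto u x
      refine ⟨σ v, (h.top_def σ hσ u v).mp huv, fun _ z hz hlt => ?_⟩
      refine hv (σ.symm z) ?_ ?_
      · rw [← hσ.pairType, Equiv.apply_symm_apply]; exact hz
      · rw [h.lt_def σ hσ, Equiv.apply_symm_apply]; exact hlt
  choose f hfG hf using hex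
  obtain ⟨m, hxm, hm⟩ := h.exists_upper_bound x f hfG
  refine ⟨m, hxm, fun z hz => ?_⟩
  by_contra hcon
  exact hf _ hcon z rfl (h.le_trans_lt (hm _) hz)

/-- If `C` is realised above every point, cofinal chains force `C`. -/
theorem rel_of_cofinal (h : S.IsDefinableSubquotientOrder E G lt) {C : Γ → Γ → Prop}
    (hC : S.Definable C) (hClt : ∀ x y, C x y → lt x y)
    (hCup : ∀ x y y', C x y → (lt y y' ∨ E y y') → C x y') (hCex : ∀ x, ∃ y, C x y)
    {z₀ z₁ z₂ w : Γ} (hcof : Cofinal S G lt (S.pairType z₀ z₁))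
    (hz : S.pairType z₀ z₁ = S.pairType z₁ z₂) (hzw : lt z₀ w ∨ E z₀ w) (hwz : lt w z₁) :
    C w z₂ := by
  by_contra hcon
  have h01 : lt z₀ z₁ := h.le_trans_lt hzw hwz
  have h12 : lt z₁ z₂ := (h.lt_def.congr_pairType h.hom hz).mp h01
  obtain ⟨y, hy⟩ := hCex w
  obtain ⟨z₃, hz3, hyz3⟩ := hcof z₂ y (h.top_equiv.trans
    (h.top_equiv.symm (h.top_of_lt (h.lt_trans hwz h12))) (h.top_of_lt (hClt _ _ hy)))
  have hwz3 : C w z₃ := hCup _ _ _ hy (Or.inl hyz3)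
  have t02 := pairType_trans hz
  have t13 := pairType_trans (hz.symm.trans hz3.symm)
  have t03 : S.pairType z₀ z₃ = S.pairType z₀ z₁ :=
    (pairType_trans (t02.trans hz3.symm)).trans t02
  obtain ⟨c, hc⟩ := h.hom.exists_chain z₀ z₁
  have hclt : ∀ j k, j < k → lt (c j) (c k) := fun j k hjk =>
    (h.lt_def.congr_pairType h.hom (hc j k hjk)).mpr h01
  have hex : ∀ a b, ∃ v, a < b → (lt (c (4 * a)) v ∨ E (c (4 * a)) v) ∧ lt v (c (4 * a + 1)) ∧
      ¬ C v (c (4 * b + 2)) ∧ C v (c (4 * b + 3)) := by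
    intro a b
    by_cases hab : a < b
    · have e01 := hc (4 * a) (4 * a + 1) (by omega)
      have e02 := hc (4 * a) (4 * b + 2) (by omega)
      have e03 := hc (4 * a) (4 * b + 3) (by omega)
      have e12 := hc (4 * a + 1) (4 * b + 2) (by omega)
      have e13 := hc (4 * a + 1) (4 * b + 3) (by omega)
      have e23 := hc (4 * b + 2) (4 * b + 3) (by omega)
      have f02 := t02.trans e02.symm
      have f03 := t03.trans e03.symm
      have f12 := hz.symm.trans e12.symm
      have f13 := (t13.trans hz.symm).trans e13.symm
      have f23 := hz3.trans e23.symm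
      obtain ⟨σ, hσ, hσ'⟩ := h.hom 4 ![z₀, z₁, z₂, z₃]
        ![c (4 * a), c (4 * a + 1), c (4 * b + 2), c (4 * b + 3)] (by
          simp [Fin.forall_fin_succ, e01.symm, pairType_swap e01.symm, f02, pairType_swap f02,
            f03, pairType_swap f03, f12, pairType_swap f12, f13, pairType_swap f13, f23,
            pairType_swap f23, pairType_self z₀ (c (4 * a)), pairType_self z₁ (c (4 * a + 1)),
            pairType_self z₂ (c (4 * b + 2)), pairType_self z₃ (c (4 * b + 3))])
      have s0 : σ z₀ = c (4 * a) := hσ' 0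
      have s1 : σ z₁ = c (4 * a + 1) := hσ' 1
      have s2 : σ z₂ = c (4 * b + 2) := hσ' 2
      have s3 : σ z₃ = c (4 * b + 3) := hσ' 3
      refine ⟨σ w, fun _ => ⟨?_, ?_, ?_, ?_⟩⟩
      · rw [← s0]; exact (h.le_def σ hσ _ _).mp hzw
      · rw [← s1]; exact (h.lt_def σ hσ _ _).mp hwz
      · rw [← s2, ← hC σ hσ]; exact hcon
      · rw [← s3, ← hC σ hσ]; exact hwz3
    · exact ⟨w, fun hab' => absurd hab' hab⟩
  choose X hX using hex
  obtain ⟨a, b, d, e, hab, hbd, hde, heq⟩ :=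
    exists_shift_triple (fun a b d => S.pairType (X a b) (X b d))
  have h1 : C (X a b) (X d e) := hCup _ _ _ (hX a b hab).2.2.2
    (Or.inl (h.lt_trans_le (hclt (4 * b + 3) (4 * d) (by omega)) (hX d e hde).1))
  have h2 : C (X b d) (X d e) :=
    (hC.congr_pairType h.hom ((pairType_trans heq).trans heq)).mp h1
  exact (hX b d hbd).2.2.1 (hCup _ _ _ h2
    (Or.inl (h.lt_trans (hX d e hde).2.1 (hclt (4 * d + 1) (4 * d + 2) (by omega)))))

theorem exists_not_rel_of_le (h : S.IsDefinableSubquotientOrder E G lt)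
    (hconv : S.NoConvex E G lt) {C : Γ → Γ → Prop}
    (hC : S.Definable C) (hClt : ∀ x y, C x y → lt x y)
    (hCup : ∀ x y y', C x y → (lt y y' ∨ E y y') → C x y')
    (hne : ∃ x y, lt x y ∧ ¬ C x y) (p q : Γ) : ∃ w, (lt w p ∨ E w p) ∧ ¬ C w q := by
  by_contra hcon
  push Not at hcon
  let D : Γ → Γ → Prop := fun x y => ∀ u, (lt u x ∨ E u x) → C u y
  have hDd : S.Definable D := definable_of_imp fun σ hσ x y hD u hu => by
    have hu' : lt (σ.symm u) x ∨ E (σ.symm u) x := by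
      rw [h.lt_def σ hσ, h.bot_def σ hσ, Equiv.apply_symm_apply]; exact hu
    have := (hC σ hσ _ _).mp (hD _ hu')
    rwa [Equiv.apply_symm_apply] at this
  have hDC : ∀ {x y}, D x y → C x y := fun {x y} hD => hD x (Or.inr (h.bot_equiv.refl x))
  have hDlt : ∀ {x y}, D x y → lt x y := fun hD => hClt _ _ (hDC hD)
  have hDdown : ∀ {x x' y}, (lt x' x ∨ E x' x) → D x y → D x' y :=
    fun hx hD u hu => hD u (h.le_trans hu hx)
  have hDup : ∀ {x y y'}, D x y → (lt y y' ∨ E y y') → D x y' :=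
    fun hD hy u hu => hCup _ _ _ (hD u hu) hy
  have hDpq : D p q := hcon
  refine hconv (fun x y => G x y ∧ ∀ z, (D x z ↔ D y z)) ?_ ?_ ?_ ?_ (fun x y hxy => hxy.1) ?_ ?_
  · refine definable_of_imp fun σ hσ x y hxy => ⟨(h.top_def σ hσ x y).mp hxy.1, fun z => ?_⟩
    have := hxy.2 (σ.symm z)
    rwa [hDd σ hσ x, hDd σ hσ y, Equiv.apply_symm_apply] at this
  · exact ⟨fun x => ⟨h.top_equiv.refl x, fun _ => Iff.rfl⟩,
      fun hxy => ⟨h.top_equiv.symm hxy.1, fun z => (hxy.2 z).symm⟩,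
      fun hxy hyz => ⟨h.top_equiv.trans hxy.1 hyz.1, fun z => (hxy.2 z).trans (hyz.2 z)⟩⟩
  · exact fun x y hxy => ⟨h.bot_le_top x y hxy, fun z =>
      ⟨hDdown (Or.inr (h.bot_equiv.symm hxy)), hDdown (Or.inr hxy)⟩⟩
  · intro hKE
    obtain ⟨x, y, hxy, hCxy⟩ := hne
    refine h.not_bot_of_lt hxy (hKE x y ⟨h.top_of_lt hxy, fun z => ⟨fun hD => ?_,
      hDdown (Or.inl hxy)⟩⟩)
    obtain ⟨v, hv1, hv2⟩ := h.hom.exists_between x z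
    have hxv : D x v := (hDd.congr_pairType h.hom hv1).mpr hD
    have hvz : D v z := (hDd.congr_pairType h.hom hv2).mpr hD
    rcases h.le_or_lt (h.top_equiv.trans (h.top_equiv.symm (h.top_of_lt (hDlt hxv)))
      (h.top_of_lt hxy)) with hvy | hyv
    · exact absurd (hDC (hDup hxv hvy)) hCxy
    · exact hDdown (Or.inl hyv) hvz
  · intro hGK
    have hqq := ((hGK p q (h.top_of_lt (hDlt hDpq))).2 q).mp hDpq
    exact h.lt_asymm (hDlt hqq) (hDlt hqq)
  · intro x y z hxy hyz hxz
    exact ⟨h.top_of_lt hxy, fun w => ⟨fun hD => hDdown (Or.inl hyz) ((hxz.2 w).mp hD),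
      hDdown (Or.inl hxy)⟩⟩

/-- Under the no-convexity hypothesis, a definable up-closed subrelation of `lt` which is not all
of `lt` is empty. -/
theorem not_rel_of_up_closed (h : S.IsDefinableSubquotientOrder E G lt)
    (hconv : S.NoConvex E G lt) {C : Γ → Γ → Prop}
    (hC : S.Definable C) (hClt : ∀ x y, C x y → lt x y)
    (hCup : ∀ x y y', C x y → (lt y y' ∨ E y y') → C x y')
    (hCE : ∀ x x' y, C x y → E x x' → C x' y)
    (hne : ∃ x y, lt x y ∧ ¬ C x y) (x y : Γ) : ¬ C x y := by
  intro hCxy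
  have hCex : ∀ x', ∃ y', C x' y' := by
    intro x'
    obtain ⟨σ, hσ, rfl⟩ := h.hom.exists_auto x x'
    exact ⟨σ y, (hC σ hσ x y).mp hCxy⟩
  obtain ⟨yc, hyc⟩ := hCex x
  have hex : ∀ t : Fin n → Prop × Prop, ∃ z, G x z ∧
      (Cofinal S G lt t → S.pairType x z = t) := by
    intro t
    by_cases ht : Cofinal S G lt t
    · obtain ⟨z, hz, hxz⟩ := ht x x (h.top_equiv.refl x)
      exact ⟨z, h.top_of_lt hxz, fun _ => hz⟩
    · exact ⟨x, h.top_equiv.refl x, fun ht' => absurd ht' ht⟩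
  choose f hfG hf using hex
  obtain ⟨m, hm1, hm2⟩ := h.exists_upper_bound yc f
    (fun t => h.top_equiv.trans (h.top_equiv.symm (h.top_of_lt (hClt _ _ hyc))) (hfG t))
  have hCxm : C x m := hCup _ _ _ hyc hm1
  obtain ⟨w, hwx, hCwm⟩ := h.exists_not_rel_of_le hconv hC hClt hCup hne x m
  have hwx' : lt w x := hwx.resolve_right
    (fun hE => hCwm (hCE _ _ _ hCxm (h.bot_equiv.symm hE)))
  have hncof : ∀ u, (lt u w ∨ E u w) → ¬ Cofinal S G lt (S.pairType u x) := fun u hu hcof =>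
    hCwm (hCup _ _ _ (h.rel_of_cofinal hC hClt hCup hCex hcof (hf _ hcof).symm hu hwx') (hm2 _))
  obtain ⟨k, hwk, hk⟩ := h.exists_cofinal_bound w
  obtain ⟨σ, hσ, rfl⟩ := h.hom.exists_auto w k
  refine hncof (σ.symm w) ?_ ?_
  · rw [h.lt_def σ hσ, h.bot_def σ hσ, Equiv.apply_symm_apply]; exact hwk
  · rw [← hσ.pairType, Equiv.apply_symm_apply]
    exact hk _ ((h.lt_def σ hσ _ _).mp hwx')

/-- Classes of a definable equivalence relation strictly above `E` are cofinal. -/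
theorem exists_rel_lt (h : S.IsDefinableSubquotientOrder E G lt) (hconv : S.NoConvex E G lt)
    {H : Γ → Γ → Prop} (hH : S.Definable H) (hHe : Equivalence H)
    (hEH : ∀ x y, E x y → H x y) (hHG : ∀ x y, H x y → G x y) (hHE : ¬ ∀ x y, H x y → E x y)
    {x y : Γ} (hxy : G x y) : ∃ x', H x x' ∧ lt y x' := by
  by_contra hcon
  push Not at hcon
  obtain ⟨p, q, hp, hlt⟩ : ∃ p q, H p q ∧ lt p q := by
    push Not at hHE
    obtain ⟨p, q, hpq, hE⟩ := hHE
    rcases h.lt_or_lt (hHG _ _ hpq) hE with h1 | h1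
    · exact ⟨p, q, hpq, h1⟩
    · exact ⟨q, p, hHe.symm hpq, h1⟩
  have hmax : ∀ x, ∃ x', H x x' ∧ lt x x' := by
    intro x
    obtain ⟨σ, hσ, rfl⟩ := h.hom.exists_auto p x
    exact ⟨σ q, (hH σ hσ _ _).mp hp, (h.lt_def σ hσ _ _).mp hlt⟩
  have hbound : ∀ x', H x x' → lt x' y := by
    intro x' hx'
    obtain ⟨x'', h1, h2⟩ := hmax x'
    rcases h.le_or_lt (h.top_equiv.trans (h.top_equiv.symm hxy)
      (hHG _ _ (hHe.trans hx' h1))) with h3 | h3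
    · rcases h3 with h3 | h3
      · exact absurd h3 (hcon _ (hHe.trans hx' h1))
      · exact h.lt_congr_right h2 (h.bot_equiv.symm h3)
    · exact h.lt_trans h2 h3
  refine h.not_rel_of_up_closed hconv (C := fun x y => ∀ x', H x x' → lt x' y) ?_
    (fun x y hC => hC x (hHe.refl x)) (fun x y y' hC hy x' hx' => h.lt_trans_le (hC x' hx') hy)
    (fun x x' y hC hx u hu => hC u (hHe.trans (hEH _ _ hx) hu))
    ⟨p, q, hlt, fun hC => h.lt_asymm (hC q hp) (hC q hp)⟩ x y hbound
  refine definable_of_imp fun σ hσ x y hC x' hx' => ?_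
  have := hC (σ.symm x') (by rw [hH σ hσ, Equiv.apply_symm_apply]; exact hx')
  rwa [h.lt_def σ hσ, Equiv.apply_symm_apply] at this

theorem noConvex_flip (hconv : S.NoConvex E G lt) : S.NoConvex E G (fun x y => lt y x) :=
  fun H hH hHe h1 h2 h3 h4 h5 => hconv H hH hHe h1 h2 h3 h4 fun x y z hxy hyz hxz =>
    hHe.trans hxz (h5 z y x hyz hxy (hHe.symm hxz))

theorem restrict (h : S.IsDefinableSubquotientOrder E G lt) {H : Γ → Γ → Prop}
    (hH : S.Definable H) (hHe : Equivalence H) (hEH : ∀ x y, E x y → H x y)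
    (hHG : ∀ x y, H x y → G x y) :
    S.IsDefinableSubquotientOrder E H (fun x y => H x y ∧ lt x y) where
  hom := h.hom
  bot_def := h.bot_def
  bot_equiv := h.bot_equiv
  top_def := hH
  top_equiv := hHe
  bot_le_top := hEH
  order := ⟨fun _ _ hxy => ⟨hxy.1, h.not_bot_of_lt hxy.2⟩,
    fun _ _ _ _ hxy hx hy => ⟨hHe.trans (hHe.symm (hEH _ _ hx)) (hHe.trans hxy.1 (hEH _ _ hy)),
      h.order.2.1 _ _ _ _ hxy.2 hx hy⟩,
    fun _ _ _ hxy hyz => ⟨hHe.trans hxy.1 hyz.1, h.lt_trans hxy.2 hyz.2⟩,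
    fun _ _ hxy hE => ⟨(h.lt_or_lt (hHG _ _ hxy) hE).imp (fun hl => ⟨hxy, hl⟩)
      (fun hl => ⟨hHe.symm hxy, hl⟩), fun hh => h.lt_asymm hh.1.2 hh.2.2⟩⟩
  lt_def := hH.and h.lt_def

end IsDefinableSubquotientOrder

/-- The composition of two definable equivalence relations is an equivalence relation. -/
theorem PairHomogeneous.comp_equivalence (hS : S.PairHomogeneous) {F G : Γ → Γ → Prop}
    (hF : S.Definable F) (hFe : Equivalence F) (hG : S.Definable G) (hGe : Equivalence G) :
    Equivalence (fun x y => ∃ z, F x z ∧ G z y) where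
  refl x := ⟨x, hFe.refl x, hGe.refl x⟩
  symm := fun ⟨z, h1, h2⟩ => hS.comm hG hGe hF hFe ⟨z, hGe.symm h2, hFe.symm h1⟩
  trans := fun ⟨_, h1, h2⟩ ⟨w, h3, h4⟩ => by
    obtain ⟨v, h5, h6⟩ := hS.comm hG hGe hF hFe ⟨_, h2, h3⟩
    exact ⟨v, hFe.trans h1 h5, hGe.trans h6 h4⟩

/-- If `lt` is convex for no intermediate relation, then `E` is not the meet of two definable
equivalence relations strictly above `E` and below `G`. -/
theorem IsDefinableSubquotientOrder.not_meet {E G lt : Γ → Γ → Prop}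
    (h : S.IsDefinableSubquotientOrder E G lt) (hconv : S.NoConvex E G lt)
    (hne : ∃ x y, lt x y) {H H' : Γ → Γ → Prop}
    (hH : S.Definable H) (hHe : Equivalence H)
    (hEH : ∀ x y, E x y → H x y) (hHG : ∀ x y, H x y → G x y) (hHE : ¬ ∀ x y, H x y → E x y)
    (hH' : S.Definable H') (hHe' : Equivalence H')
    (hEH' : ∀ x y, E x y → H' x y) (hHG' : ∀ x y, H' x y → G x y)
    (hHE' : ¬ ∀ x y, H' x y → E x y) (hmeet : ∀ x y, H' x y → H x y → E x y) : False := by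
  obtain ⟨x₀, s, hs⟩ := hne
  have hstep : ∀ x : {x // lt x s}, ∃ (b : Γ) (y : {x // lt x s}),
      H x b ∧ lt s b ∧ H' b y := by
    rintro ⟨x, hx⟩
    obtain ⟨b, hb1, hb2⟩ := h.exists_rel_lt hconv hH hHe hEH hHG hHE (h.top_of_lt hx)
    obtain ⟨y, hy1, hy2⟩ := h.flip.exists_rel_lt (noConvex_flip hconv) hH' hHe' hEH' hHG' hHE'
      (h.top_equiv.symm (h.top_of_lt hb2))
    exact ⟨b, ⟨y, hy2⟩, hb1, hb2, hy1⟩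
  choose β next hβ1 hβ2 hβ3 using hstep
  let a' : ℕ → {x // lt x s} := fun k => next^[k] ⟨x₀, hs⟩
  let a : ℕ → Γ := fun k => a' k
  let b : ℕ → Γ := fun k => β (a' k)
  have hab : ∀ k, H (a k) (b k) := fun k => hβ1 _
  have hsb : ∀ k, lt s (b k) := fun k => hβ2 _
  have has : ∀ k, lt (a k) s := fun k => (a' k).2
  have hba : ∀ k, H' (b k) (a (k + 1)) := by
    intro k
    have : a (k + 1) = next (a' k) := by
      simp only [a, a', Function.iterate_succ_apply']
    rw [this]
    exact hβ3 _
  have hR := h.hom.comp_equivalence hH' hHe' hH hHe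
  have hR0 : ∀ k, ∃ w, H' (a 0) w ∧ H w (a k) := by
    intro k
    induction k with
    | zero => exact hR.refl _
    | succ k ih => exact hR.trans ih (hR.symm ⟨b k, hHe'.symm (hba k), hHe.symm (hab k)⟩)
  have hQ : ∀ j k, ∃ w, H' (a j) w ∧ H w (a k) := fun j k => hR.trans (hR.symm (hR0 j)) (hR0 k)
  choose Q hQ' hQ using hQ
  have hclaim : ∀ j k, j < k → ∀ v, H' v (a k) → H v (a j) → lt s v := by
    intro j k hjk
    induction k, hjk using Nat.le_induction with
    | base =>
      intro v hv' hv
      exact h.lt_congr_right (hsb j) (hmeet _ _ (hHe'.trans (hba j) (hHe'.symm hv'))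
        (hHe.trans (hHe.symm (hab j)) (hHe.symm hv)))
    | succ k hk ih =>
      intro v hv' hv
      have hu := ih (Q k j) (hHe'.symm (hQ' k j)) (hQ k j)
      have hr := h.restrict hH hHe hEH hHG
      exact h.lt_trans hu (h.hom.lt_of_lt_of_rel h.bot_equiv hH' hHe' hH hHe hEH' hmeet hr.order
        hr.lt_def (hQ' k j) (hHe'.trans (hba k) (hHe'.symm hv'))
        (hHe.trans (hQ k j) (hHe.symm hv)) ⟨hab k, h.lt_trans (has k) (hsb k)⟩).2
  obtain ⟨i, j, k, l, hij, hjk, hkl, heq⟩ := exists_shift_triple (fun i j k =>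
    (S.pairType (Q i j) (Q j k), S.pairType s (Q i j)))
  simp only [Prod.mk.injEq] at heq
  obtain ⟨σ, hσ, h1, h2, h3⟩ := h.hom.exists_auto_triple (rfl : S.pairType s (Q k l) = _)
    heq.2.symm (pairType_eq_pairType_left heq.1).symm
  have e1 : H' (σ (a k)) (a k) := by
    have := hQ' k l
    rw [hH' σ hσ, h2] at this
    exact hHe'.trans this (hHe'.symm (hQ' k l))
  have e2 : H (σ (a k)) (a j) := by
    have := hQ j k
    rw [hH σ hσ, h3] at this
    exact hHe.trans (hHe.symm this) (hQ i j)
  have e3 : lt (σ (a k)) s := by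
    have := has k
    rwa [h.lt_def σ hσ, h1] at this
  exact h.lt_asymm e3 (hclaim j k hjk _ e1 e2)

theorem pos_of_isSubquotientOrder (hhom : S.Homogeneous) {E G lt : Γ → Γ → Prop}
    (hlt : IsSubquotientOrder E G lt) (hltd : S.Definable lt) (hE : Equivalence E)
    (hGE : ¬ ∀ x y, G x y → E x y) : 0 < n := by
  classical
  rw [Nat.pos_iff_ne_zero]
  rintro rfl
  push Not at hGE
  obtain ⟨x, y, hxy, hne⟩ := hGE
  have hxy' : x ≠ y := by
    rintro rfl
    exact hne (hE.refl x)
  obtain ⟨σ, hσ, hσ'⟩ := hhom {x, y} (Equiv.swap x y) (Equiv.swap x y).injective.injOn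
    (fun i => i.elim0)
  have h1 : σ x = y := by rw [hσ' x (by simp), Equiv.swap_apply_left]
  have h2 : σ y = x := by rw [hσ' y (by simp), Equiv.swap_apply_right]
  have h3 : lt x y ↔ lt y x := by rw [hltd σ hσ, h1, h2]
  have := hlt.2.2.2 x y hxy hne
  tauto

theorem PairHomogeneous.transGen_iff (hS : S.PairHomogeneous) {F G : Γ → Γ → Prop}
    (hF : S.Definable F) (hFe : Equivalence F) (hG : S.Definable G) (hGe : Equivalence G)
    (x y : Γ) : Relation.TransGen (fun u v => F u v ∨ G u v) x y ↔ ∃ z, F x z ∧ G z y := by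
  have hR := hS.comp_equivalence hF hFe hG hGe
  have hsub : ∀ {u v}, F u v ∨ G u v → ∃ z, F u z ∧ G z v := by
    rintro u v (h | h)
    · exact ⟨v, h, hGe.refl v⟩
    · exact ⟨u, hFe.refl u, h⟩
  refine ⟨fun h => ?_, fun ⟨z, h1, h2⟩ => .tail (.single (Or.inl h1)) (Or.inr h2)⟩
  induction h with
  | single h => exact hsub h
  | tail _ h ih => exact hR.trans ih (hsub h)

/-- If `F ⊓ G = E`, the order `lt` from `E` to `G` lifts to an order from `F` to `F ⊔ G`. -/
theorem IsDefinableSubquotientOrder.lift {E G lt F : Γ → Γ → Prop}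
    (h : S.IsDefinableSubquotientOrder E G lt) (hF : S.Definable F) (hFe : Equivalence F)
    (hEF : ∀ x y, E x y → F x y) (hFG : ∀ x y, F x y → G x y → E x y) :
    S.Definable (fun x y => ∃ z, F x z ∧ lt z y) ∧
    IsSubquotientOrder F (fun x y => Relation.TransGen (fun u v => F u v ∨ G u v) x y)
      (fun x y => ∃ z, F x z ∧ lt z y) ∧
    ∀ x y, lt x y ↔ (G x y ∧ ∃ z, F x z ∧ lt z y) := by
  have hR := h.hom.comp_equivalence hF hFe h.top_def h.top_equiv
  have hright : ∀ {x y y'}, (∃ z, F x z ∧ lt z y) → F y y' → ∃ z, F x z ∧ lt z y' := by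
    rintro x y y' ⟨z, hz, hzy⟩ hy
    obtain ⟨z', h1, h2⟩ := h.hom.comm h.top_def h.top_equiv hF hFe ⟨y, h.top_of_lt hzy, hy⟩
    exact ⟨z', hFe.trans hz h1, h.hom.lt_of_lt_of_rel h.bot_equiv hF hFe h.top_def h.top_equiv
      hEF hFG h.order h.lt_def h1 hy h2 hzy⟩
  have hirr : ∀ {x y}, (∃ z, F x z ∧ lt z y) → ¬ F x y := by
    rintro x y ⟨z, hz, hzy⟩ hxy
    exact h.not_bot_of_lt hzy (hFG _ _ (hFe.trans (hFe.symm hz) hxy) (h.top_of_lt hzy))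
  have htrans : ∀ {x y z}, (∃ u, F x u ∧ lt u y) → (∃ u, F y u ∧ lt u z) →
      ∃ u, F x u ∧ lt u z := by
    rintro x y z hxy ⟨v, hv, hvz⟩
    obtain ⟨u, hu, huv⟩ := hright hxy hv
    exact ⟨u, hu, h.lt_trans huv hvz⟩
  refine ⟨definable_of_imp fun σ hσ x y ⟨z, h1, h2⟩ =>
    ⟨σ z, (hF σ hσ _ _).mp h1, (h.lt_def σ hσ _ _).mp h2⟩, ⟨?_, ?_, ?_, ?_⟩, ?_⟩
  · rintro x y ⟨z, h1, h2⟩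
    exact ⟨(h.hom.transGen_iff hF hFe h.top_def h.top_equiv x y).mpr ⟨z, h1, h.top_of_lt h2⟩,
      hirr ⟨z, h1, h2⟩⟩
  · rintro x y x' y' ⟨z, h1, h2⟩ hx hy
    exact hright ⟨z, hFe.trans (hFe.symm hx) h1, h2⟩ hy
  · exact fun x y z => htrans
  · intro x y hxy hnF
    refine ⟨?_, fun hh => hirr (htrans hh.1 hh.2) (hFe.refl x)⟩
    obtain ⟨z, h1, h2⟩ := (h.hom.transGen_iff hF hFe h.top_def h.top_equiv x y).mp hxy
    rcases h.lt_or_lt h2 (fun hE => hnF (hFe.trans h1 (hEF _ _ hE))) with h3 | h3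
    · exact Or.inl ⟨z, h1, h3⟩
    · exact Or.inr (hright ⟨y, hFe.refl y, h3⟩ (hFe.symm h1))
  · refine fun x y => ⟨fun hl => ⟨h.top_of_lt hl, x, hFe.refl x, hl⟩, ?_⟩
    rintro ⟨hG, z, h1, h2⟩
    exact h.lt_congr_left h2 (h.bot_equiv.symm (hFG _ _ h1
      (h.top_equiv.trans hG (h.top_equiv.symm (h.top_of_lt h2)))))

end PairTypes

end PermStruct

/-- In a homogeneous `n`-dimensional permutation structure, let `E < G` be ∅-definable
equivalence relations with `E` meet-reducible, and `<` a ∅-definable subquotient order from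
`E` to `G` which is `H`-convex for no ∅-definable equivalence relation `H` strictly between
`E` and `G`. Then there are a ∅-definable equivalence relation `F > E` and a ∅-definable
subquotient order `<'` from `F` to `F ⊔ G` such that `<` is the restriction of `<'` to `G`,
and `<` and `<'` are interdefinable via `x <' y ↔ ∃ z, x F z ∧ z < y`. -/
theorem subquotient_order_lifts_to_meet_irreducible_step
    {n : ℕ} {Γ : Type*} [Countable Γ] [Infinite Γ] (S : PermStruct n Γ)
    (hhom : S.Homogeneous)
    (E G : Γ → Γ → Prop) (lt : Γ → Γ → Prop)
    (hEdef : S.Definable E) (hEequiv : Equivalence E)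
    (hGdef : S.Definable G) (hGequiv : Equivalence G)
    (hEG : ∀ x y, E x y → G x y) (hEGne : ¬ ∀ x y, G x y → E x y)
    (hred : ∃ G₁ G₂ : Γ → Γ → Prop, S.Definable G₁ ∧ Equivalence G₁ ∧
      S.Definable G₂ ∧ Equivalence G₂ ∧
      (¬ ∀ x y, G₁ x y ↔ E x y) ∧ (¬ ∀ x y, G₂ x y ↔ E x y) ∧
      (∀ x y, E x y ↔ G₁ x y ∧ G₂ x y))
    (hlt : IsSubquotientOrder E G lt) (hltdef : S.Definable lt)
    (hnoconv : ∀ H : Γ → Γ → Prop, S.Definable H → Equivalence H →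
      (∀ x y, E x y → H x y) → (¬ ∀ x y, H x y → E x y) →
      (∀ x y, H x y → G x y) → (¬ ∀ x y, G x y → H x y) →
      ¬ (∀ x y z, lt x y → lt y z → H x z → H x y)) :
    ∃ (F : Γ → Γ → Prop) (lt' : Γ → Γ → Prop),
      S.Definable F ∧ Equivalence F ∧
      (∀ x y, E x y → F x y) ∧ (¬ ∀ x y, F x y → E x y) ∧
      S.Definable lt' ∧
      IsSubquotientOrder F (fun x y => Relation.TransGen (fun u v => F u v ∨ G u v) x y) lt' ∧
      (∀ x y, lt x y ↔ (G x y ∧ lt' x y)) ∧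
      (∀ x y, lt' x y ↔ ∃ z, F x z ∧ lt z y) := by
  have hn := PermStruct.pos_of_isSubquotientOrder hhom hlt hltdef hEequiv hEGne
  have h : S.IsDefinableSubquotientOrder E G lt :=
    ⟨hhom.pairHomogeneous hn, hEdef, hEequiv, hGdef, hGequiv, hEG, hlt, hltdef⟩
  suffices hF : ∃ F : Γ → Γ → Prop, S.Definable F ∧ Equivalence F ∧ (∀ x y, E x y → F x y) ∧
      (¬ ∀ x y, F x y → E x y) ∧ ∀ x y, F x y → G x y → E x y by
    obtain ⟨F, hF, hFe, hEF, hFE, hFG⟩ := hF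
    obtain ⟨h1, h2, h3⟩ := h.lift hF hFe hEF hFG
    exact ⟨F, _, hF, hFe, hEF, hFE, h1, h2, h3, fun _ _ => Iff.rfl⟩
  obtain ⟨G₁, G₂, hd₁, he₁, hd₂, he₂, hne₁, hne₂, hinf⟩ := hred
  have hE₁ : ∀ x y, E x y → G₁ x y := fun x y hE => ((hinf x y).mp hE).1
  have hE₂ : ∀ x y, E x y → G₂ x y := fun x y hE => ((hinf x y).mp hE).2
  by_cases hc₁ : ∀ x y, G₁ x y → G x y → E x y
  · exact ⟨G₁, hd₁, he₁, hE₁, fun hh => hne₁ fun x y => ⟨hh x y, hE₁ x y⟩, hc₁⟩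
  by_cases hc₂ : ∀ x y, G₂ x y → G x y → E x y
  · exact ⟨G₂, hd₂, he₂, hE₂, fun hh => hne₂ fun x y => ⟨hh x y, hE₂ x y⟩, hc₂⟩
  have hex : ∃ x y, lt x y := by
    push Not at hEGne
    obtain ⟨x, y, hxy, hE⟩ := hEGne
    exact (h.lt_or_lt hxy hE).elim (fun hl => ⟨x, y, hl⟩) (fun hl => ⟨y, x, hl⟩)
  have hinter : ∀ {K : Γ → Γ → Prop}, Equivalence K → Equivalence (fun x y => K x y ∧ G x y) :=
    fun hK => ⟨fun x => ⟨hK.refl x, hGequiv.refl x⟩,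
      fun hxy => ⟨hK.symm hxy.1, hGequiv.symm hxy.2⟩,
      fun hxy hyz => ⟨hK.trans hxy.1 hyz.1, hGequiv.trans hxy.2 hyz.2⟩⟩
  exact (h.not_meet hnoconv hex (hd₁.and hGdef) (hinter he₁)
    (fun x y hE => ⟨hE₁ x y hE, hEG x y hE⟩) (fun _ _ hxy => hxy.2)
    (fun hh => hc₁ fun x y hx hy => hh x y ⟨hx, hy⟩)
    (hd₂.and hGdef) (hinter he₂)
    (fun x y hE => ⟨hE₂ x y hE, hEG x y hE⟩) (fun _ _ hxy => hxy.2)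
    (fun hh => hc₂ fun x y hx hy => hh x y ⟨hx, hy⟩)
    (fun x y h₂ h₁ => (hinf x y).mpr ⟨h₁.1, h₂.1⟩)).elim
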